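/- Assume the coercivity conditions: S^j = Σ_{i=1}^{j} [κ_{i−1}(u_i−u_{i−1}) + d_i] ≥ 0 for all j = 1,…,n, and S_j = Σ_{i=j}^{n} [κ_i(u_{i+1}−u_i) + d_i] ≥ 0 for all j = 1,…,n. Then for every c ∈ ℝ the sub-level set Ω_c = {ξ̄ ∈ Ω : E(ξ̄) ≤ c} is bounded in ℝⁿ. -/

import Mathlib

open Real Filter Finset

/-- The rescaled Gaussian cumulative distribution function
`F(ξ) = (1/(2√π)) ∫_{-∞}^{ξ} e^{-s²/4} ds`. -/
noncomputable def F (x : ℝ) : ℝ :=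
  (1 / (2 * Real.sqrt Real.pi)) * ∫ s in Set.Iio x, Real.exp (-s ^ 2 / 4)

/-- The derivative `F'(ξ) = (1/(2√π)) e^{-ξ²/4}`. -/
noncomputable def F' (x : ℝ) : ℝ :=
  (1 / (2 * Real.sqrt Real.pi)) * Real.exp (-x ^ 2 / 4)

/-- The functional
`E(ξ̄) = −Σ_{i=0}^{n} k_i(u_{i+1}−u_i) ln(F(ξ_{i+1}/a_i) − F(ξ_i/a_i)) + Σ_{i=1}^{n} d_i ξ_i²/4`,
with the conventions `ξ₀ = −∞`, `ξ_{n+1} = +∞`, i.e. `F(ξ₀/a₀) = 0`, `F(ξ_{n+1}/a_n) = 1`.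
Here `ξ : ℕ → ℝ`, only the values `ξ 1, …, ξ n` being relevant. -/
noncomputable def E (n : ℕ) (u a k d : ℕ → ℝ) (ξ : ℕ → ℝ) : ℝ :=
  -(∑ i ∈ Finset.range (n + 1), k i * (u (i + 1) - u i) *
      Real.log ((if i = n then 1 else F (ξ (i + 1) / a i)) -
        (if i = 0 then 0 else F (ξ i / a i))))
  + ∑ i ∈ Finset.Icc 1 n, d i * ξ i ^ 2 / 4

/-- Reindexing of a point of `ℝⁿ` as the sequence `ξ_1, …, ξ_n` (paper indexing). -/
noncomputable def toSeq (n : ℕ) (x : EuclideanSpace ℝ (Fin n)) : ℕ → ℝ :=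
  fun i => if h : i - 1 < n then x ⟨i - 1, h⟩ else 0

/-- The left-hand side of the `i`-th equation (`1 ≤ i ≤ n`) of the Stefan system:
`d_i ξ_i/2 + k_i(u_{i+1}−u_i) F'(ξ_i/a_i)/(a_i (F(ξ_{i+1}/a_i) − F(ξ_i/a_i)))
 − k_{i−1}(u_i−u_{i−1}) F'(ξ_i/a_{i−1})/(a_{i−1} (F(ξ_i/a_{i−1}) − F(ξ_{i−1}/a_{i−1})))`,
with the conventions `ξ₀ = −∞` (so `F(ξ₀/a₀) = 0`) and `ξ_{n+1} = +∞` (so `F(ξ_{n+1}/a_n) = 1`). -/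
noncomputable def stefanLHS (n : ℕ) (u a k d : ℕ → ℝ) (ξ : ℕ → ℝ) (i : ℕ) : ℝ :=
  d i * ξ i / 2
  + k i * (u (i + 1) - u i) * F' (ξ i / a i) /
      (a i * ((if i = n then 1 else F (ξ (i + 1) / a i)) - F (ξ i / a i)))
  - k (i - 1) * (u i - u (i - 1)) * F' (ξ i / a (i - 1)) /
      (a (i - 1) * (F (ξ i / a (i - 1)) - (if i = 1 then 0 else F (ξ (i - 1) / a (i - 1)))))

lemma integrable_exp_neg_sq_div_four :
    MeasureTheory.Integrable (fun s : ℝ => Real.exp (-s ^ 2 / 4)) := by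
  have h := integrable_exp_neg_mul_sq (b := 1 / 4) (by norm_num)
  refine h.congr (Eventually.of_forall fun s => ?_)
  dsimp only
  congr 1
  ring

lemma integral_exp_neg_sq_div_four :
    ∫ s : ℝ, Real.exp (-s ^ 2 / 4) = 2 * √π := by
  have h := integral_gaussian (1 / 4)
  have h4 : √(π / (1 / 4)) = 2 * √π := by
    rw [show π / (1 / 4) = 2 ^ 2 * π by ring, Real.sqrt_mul (by positivity),
      Real.sqrt_sq (by norm_num)]
  rw [← h4, ← h]
  congr 1
  ext s
  congr 1
  ring

lemma one_sub_F (x : ℝ) :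
    1 - F x = 1 / (2 * √π) * ∫ s in Set.Ioi x, Real.exp (-s ^ 2 / 4) := by
  have h := intervalIntegral.integral_Iic_add_Ioi (b := x)
    integrable_exp_neg_sq_div_four.integrableOn integrable_exp_neg_sq_div_four.integrableOn
  rw [integral_exp_neg_sq_div_four, MeasureTheory.integral_Iic_eq_integral_Iio] at h
  have hpi : 0 < √π := Real.sqrt_pos.2 Real.pi_pos
  rw [eq_sub_of_add_eq' h, F]
  field_simp

lemma F_neg (x : ℝ) : F (-x) = 1 - F x := by
  rw [one_sub_F, F, ← MeasureTheory.integral_Iic_eq_integral_Iio, ← integral_comp_neg_Ioi]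
  simp

lemma F_strictMono : StrictMono F := by
  intro x y hxy
  have hpi : 0 < √π := Real.sqrt_pos.2 Real.pi_pos
  rw [F, F]
  refine mul_lt_mul_of_pos_left ?_ (by positivity)
  rw [← MeasureTheory.integral_Iic_eq_integral_Iio, ← MeasureTheory.integral_Iic_eq_integral_Iio,
    ← sub_pos, intervalIntegral.integral_Iic_sub_Iic
      integrable_exp_neg_sq_div_four.integrableOn integrable_exp_neg_sq_div_four.integrableOn]
  exact intervalIntegral.intervalIntegral_pos_of_pos
    integrable_exp_neg_sq_div_four.intervalIntegrable (fun s => Real.exp_pos _) hxy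

lemma F_nonneg (x : ℝ) : 0 ≤ F x :=
  mul_nonneg (by positivity) (MeasureTheory.integral_nonneg fun _ => (Real.exp_pos _).le)

lemma F_pos (x : ℝ) : 0 < F x :=
  (F_nonneg (x - 1)).trans_lt (F_strictMono (by linarith))

lemma F_lt_one (x : ℝ) : F x < 1 := by
  linarith [F_pos (-x), F_neg x]

/-- Mills-type bound for the Gaussian tail, valid on the whole half-line. -/
lemma one_sub_F_le {x : ℝ} (hx : 0 ≤ x) :
    1 - F x ≤ Real.exp (-x ^ 2 / 4) / (1 + x) := by
  have hpi : 0 < √π := Real.sqrt_pos.2 Real.pi_pos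
  have hneg : -(1 + x) / 2 < 0 := by linarith
  have hint := integrableOn_exp_mul_Ioi hneg x
  have hle : ∫ s in Set.Ioi x, Real.exp (-s ^ 2 / 4) ≤
      ∫ s in Set.Ioi x, Real.exp (-x ^ 2 / 4 + 1 / 4 + (1 + x) * x / 2) *
        Real.exp (-(1 + x) / 2 * s) := by
    refine MeasureTheory.integral_mono integrable_exp_neg_sq_div_four.integrableOn
      (hint.const_mul _) fun s => ?_
    dsimp only
    rw [← Real.exp_add, Real.exp_le_exp]
    nlinarith [sq_nonneg (s - x - 1)]
  rw [MeasureTheory.integral_const_mul, integral_exp_mul_Ioi hneg] at hle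
  have hval : Real.exp (-x ^ 2 / 4 + 1 / 4 + (1 + x) * x / 2) *
      (-Real.exp (-(1 + x) / 2 * x) / (-(1 + x) / 2)) =
      2 * Real.exp (1 / 4) * (Real.exp (-x ^ 2 / 4) / (1 + x)) := by
    have h1 : Real.exp (-x ^ 2 / 4 + 1 / 4 + (1 + x) * x / 2) * Real.exp (-(1 + x) / 2 * x) =
        Real.exp (1 / 4) * Real.exp (-x ^ 2 / 4) := by
      rw [← Real.exp_add, ← Real.exp_add]
      congr 1
      ring
    have hx1 : 1 + x ≠ 0 := by positivity
    calc _ = 2 * (Real.exp (-x ^ 2 / 4 + 1 / 4 + (1 + x) * x / 2) *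
          Real.exp (-(1 + x) / 2 * x)) / (1 + x) := by field_simp
      _ = _ := by rw [h1]; ring
  have hexp : Real.exp (1 / 4) ≤ √π := by
    refine Real.le_sqrt_of_sq_le ?_
    rw [← Real.exp_nat_mul]
    have : Real.exp ((2 : ℕ) * (1 / 4)) ≤ Real.exp 1 :=
      Real.exp_le_exp.2 (by norm_num)
    linarith [Real.exp_one_lt_d9, Real.pi_gt_three]
  rw [hval] at hle
  rw [one_sub_F]
  have hT : 0 ≤ Real.exp (-x ^ 2 / 4) / (1 + x) := by positivity
  calc 1 / (2 * √π) * ∫ s in Set.Ioi x, Real.exp (-s ^ 2 / 4)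
      ≤ 1 / (2 * √π) * (2 * √π * (Real.exp (-x ^ 2 / 4) / (1 + x))) := by
        refine mul_le_mul_of_nonneg_left (hle.trans ?_) (by positivity)
        gcongr
    _ = _ := by field_simp

lemma one_sub_F_le_max (x : ℝ) :
    1 - F x ≤ Real.exp (-(max x 0) ^ 2 / 4) / (1 + max x 0) := by
  rcases le_total 0 x with h | h
  · rw [max_eq_left h]
    exact one_sub_F_le h
  · rw [max_eq_right h]
    norm_num
    exact F_nonneg x

lemma F_le_max (x : ℝ) :
    F x ≤ Real.exp (-(max (-x) 0) ^ 2 / 4) / (1 + max (-x) 0) := by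
  have h := one_sub_F_le_max (-x)
  rwa [F_neg, sub_sub_cancel] at h

lemma log_le_of_le_tails {D p q : ℝ} (hD : 0 < D) (hp : 0 ≤ p) (hq : 0 ≤ q)
    (hpq : p = 0 ∨ q = 0) (h1 : D ≤ Real.exp (-p ^ 2 / 4) / (1 + p))
    (h2 : D ≤ Real.exp (-q ^ 2 / 4) / (1 + q)) :
    (p ^ 2 / 4 + Real.log (1 + p)) + (q ^ 2 / 4 + Real.log (1 + q)) ≤ -Real.log D := by
  have key : ∀ {r : ℝ}, 0 ≤ r → D ≤ Real.exp (-r ^ 2 / 4) / (1 + r) →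
      r ^ 2 / 4 + Real.log (1 + r) ≤ -Real.log D := by
    intro r hr h
    have := Real.log_le_log hD h
    rw [Real.log_div (Real.exp_pos _).ne' (by positivity), Real.log_exp] at this
    linarith
  rcases hpq with rfl | rfl
  · simpa using key hq h2
  · simpa using key hp h1

/-- Abel summation: nonnegative partial sums against an antitone nonnegative weight. -/
lemma sum_mul_nonneg_of_antitone (b y : ℕ → ℝ) (n : ℕ) (hn : 1 ≤ n)
    (hb : ∀ j, 1 ≤ j → j ≤ n → 0 ≤ ∑ i ∈ Finset.Icc 1 j, b i)
    (hy : ∀ i, 1 ≤ i → i ≤ n → 0 ≤ y i)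
    (hmono : ∀ i, 1 ≤ i → i + 1 ≤ n → y (i + 1) ≤ y i) :
    0 ≤ ∑ i ∈ Finset.Icc 1 n, b i * y i := by
  have key : ∀ j, 1 ≤ j → j ≤ n →
      (∑ i ∈ Finset.Icc 1 j, b i) * y j ≤ ∑ i ∈ Finset.Icc 1 j, b i * y i := by
    intro j hj
    induction j, hj using Nat.le_induction with
    | base => simp
    | succ j hj ih =>
      intro hjn
      rw [Finset.sum_Icc_succ_top (by omega), Finset.sum_Icc_succ_top (by omega)]
      nlinarith [ih (by omega), mul_le_mul_of_nonneg_left (hmono j hj hjn) (hb j hj (by omega))]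
  exact (mul_nonneg (hb n hn le_rfl) (hy n hn le_rfl)).trans (key n hn le_rfl)

/-- Abel summation: nonnegative tail sums against a monotone nonnegative weight. -/
lemma sum_mul_nonneg_of_monotone (b y : ℕ → ℝ) (n : ℕ) (hn : 1 ≤ n)
    (hb : ∀ j, 1 ≤ j → j ≤ n → 0 ≤ ∑ i ∈ Finset.Icc j n, b i)
    (hy : ∀ i, 1 ≤ i → i ≤ n → 0 ≤ y i)
    (hmono : ∀ i, 1 ≤ i → i + 1 ≤ n → y i ≤ y (i + 1)) :
    0 ≤ ∑ i ∈ Finset.Icc 1 n, b i * y i := by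
  have key : ∀ m j, 1 ≤ j → j + m = n →
      (∑ i ∈ Finset.Icc j n, b i) * y j ≤ ∑ i ∈ Finset.Icc j n, b i * y i := by
    intro m
    induction m with
    | zero =>
      rintro j - rfl
      simp
    | succ m ih =>
      intro j hj hjn
      have hIcc : Finset.Icc j n = insert j (Finset.Icc (j + 1) n) := by
        ext i
        simp only [Finset.mem_insert, Finset.mem_Icc]
        omega
      rw [hIcc, Finset.sum_insert (by simp), Finset.sum_insert (by simp)]
      nlinarith [ih (j + 1) (by omega) (by omega),
        mul_le_mul_of_nonneg_left (hmono j hj (by omega)) (hb (j + 1) (by omega) (by omega))]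
  exact (mul_nonneg (hb 1 le_rfl hn) (hy 1 le_rfl hn)).trans (key (n - 1) 1 le_rfl (by omega))

lemma sum_Icc_one_eq_sum_range (f : ℕ → ℝ) (n : ℕ) :
    ∑ i ∈ Finset.Icc 1 n, f i = ∑ i ∈ Finset.range n, f (i + 1) := by
  induction n with
  | zero => simp
  | succ n ih => rw [Finset.sum_Icc_succ_top (by omega), Finset.sum_range_succ, ih]

/-- Lower bound for one logarithmic term of `E`. -/
lemma neg_log_F_sub_ge (n : ℕ) (a ξ : ℕ → ℝ) (hn : 1 ≤ n) (ha : ∀ i ≤ n, 0 < a i)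
    (hξ : ∀ i, 1 ≤ i → i + 1 ≤ n → ξ i < ξ (i + 1)) (i : ℕ) (hi : i ≤ n) (p q : ℝ)
    (hp : p = if i = 0 then 0 else max (ξ i / a i) 0)
    (hq : q = if i = n then 0 else max (-(ξ (i + 1) / a i)) 0) :
    (p ^ 2 / 4 + Real.log (1 + p)) + (q ^ 2 / 4 + Real.log (1 + q)) ≤
      -Real.log ((if i = n then 1 else F (ξ (i + 1) / a i)) -
        (if i = 0 then 0 else F (ξ i / a i))) := by
  have hai := ha i hi
  have hA : (if i = n then 1 else F (ξ (i + 1) / a i)) ≤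
      Real.exp (-q ^ 2 / 4) / (1 + q) := by
    rw [hq]
    split_ifs
    · simp
    · exact F_le_max _
  have hB : 1 - (if i = 0 then 0 else F (ξ i / a i)) ≤ Real.exp (-p ^ 2 / 4) / (1 + p) := by
    rw [hp]
    split_ifs
    · simp
    · exact one_sub_F_le_max _
  have hA1 : (if i = n then 1 else F (ξ (i + 1) / a i)) ≤ 1 := by
    split_ifs
    exacts [le_rfl, (F_lt_one _).le]
  have hB0 : 0 ≤ (if i = 0 then 0 else F (ξ i / a i)) := by
    split_ifs
    exacts [le_rfl, F_nonneg _]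
  have hlt : i ≠ 0 → i ≠ n → ξ i / a i < ξ (i + 1) / a i := fun h0 h1 =>
    div_lt_div_of_pos_right (hξ i (by omega) (by omega)) hai
  refine log_le_of_le_tails ?_ ?_ ?_ ?_ (by linarith) (by linarith)
  · rw [sub_pos]
    split_ifs with h0 h1 h1
    · omega
    · exact F_pos _
    · exact F_lt_one _
    · exact F_strictMono (hlt h0 h1)
  · rw [hp]
    split_ifs
    exacts [le_rfl, le_max_right _ _]
  · rw [hq]
    split_ifs
    exacts [le_rfl, le_max_right _ _]
  · by_cases h0 : i = 0
    · simp [hp, h0]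
    by_cases h1 : i = n
    · simp [hq, h1]
    rw [hp, hq, if_neg h0, if_neg h1]
    rcases le_total (ξ i / a i) 0 with h | h
    · exact Or.inl (max_eq_right h)
    · exact Or.inr (max_eq_right (by linarith [hlt h0 h1]))

/-- Under the coercivity conditions `E` dominates a sum of logarithms. -/
lemma sum_log_le_E (n : ℕ) (hn : 1 ≤ n) (u a k d ξ : ℕ → ℝ)
    (hu : ∀ i ≤ n, u i < u (i + 1))
    (ha : ∀ i ≤ n, 0 < a i)
    (hk : ∀ i ≤ n, 0 < k i)
    (hS1 : ∀ j, 1 ≤ j → j ≤ n →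
      0 ≤ ∑ i ∈ Finset.Icc 1 j, (k (i - 1) / a (i - 1) ^ 2 * (u i - u (i - 1)) + d i))
    (hS2 : ∀ j, 1 ≤ j → j ≤ n →
      0 ≤ ∑ i ∈ Finset.Icc j n, (k i / a i ^ 2 * (u (i + 1) - u i) + d i))
    (hξ : ∀ i, 1 ≤ i → i + 1 ≤ n → ξ i < ξ (i + 1)) :
    ∑ i ∈ Finset.Icc 1 n, (k i * (u (i + 1) - u i) * Real.log (1 + max (ξ i / a i) 0) +
      k (i - 1) * (u i - u (i - 1)) * Real.log (1 + max (-(ξ i / a (i - 1))) 0)) ≤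
      E n u a k d ξ := by
  set p : ℕ → ℝ := fun i => if i = 0 then 0 else max (ξ i / a i) 0 with hp
  set q : ℕ → ℝ := fun i => if i = n then 0 else max (-(ξ (i + 1) / a i)) 0 with hq
  set h : ℝ → ℝ := fun r => r ^ 2 / 4 + Real.log (1 + r) with hh
  have hlow : ∑ i ∈ Finset.range (n + 1), k i * (u (i + 1) - u i) * (h (p i) + h (q i)) ≤
      -(∑ i ∈ Finset.range (n + 1), k i * (u (i + 1) - u i) *
        Real.log ((if i = n then 1 else F (ξ (i + 1) / a i)) -
          (if i = 0 then 0 else F (ξ i / a i)))) := by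
    rw [← Finset.sum_neg_distrib]
    refine Finset.sum_le_sum fun i hi => ?_
    have hin : i ≤ n := Nat.lt_succ_iff.1 (Finset.mem_range.1 hi)
    rw [← mul_neg]
    exact mul_le_mul_of_nonneg_left
      (neg_log_F_sub_ge n a ξ hn ha hξ i hin _ _ rfl rfl)
      (mul_pos (hk i hin) (sub_pos.2 (hu i hin))).le
  have hsum : ∑ i ∈ Finset.range (n + 1), k i * (u (i + 1) - u i) * (h (p i) + h (q i)) =
      ∑ i ∈ Finset.Icc 1 n, (k i * (u (i + 1) - u i) * h (max (ξ i / a i) 0) +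
        k (i - 1) * (u i - u (i - 1)) * h (max (-(ξ i / a (i - 1))) 0)) := by
    have h0 : h 0 = 0 := by simp [hh]
    simp only [mul_add]
    rw [Finset.sum_add_distrib, Finset.sum_add_distrib, Finset.sum_range_succ',
      Finset.sum_range_succ (fun i => k i * (u (i + 1) - u i) * h (q i)),
      sum_Icc_one_eq_sum_range, sum_Icc_one_eq_sum_range]
    congr 1
    · simp [hp, h0]
    · simp only [hq, if_true, h0, mul_zero, add_zero, Nat.add_sub_cancel]
      refine Finset.sum_congr rfl fun i hi => ?_
      rw [if_neg (Finset.mem_range.1 hi).ne]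
  have hP := sum_mul_nonneg_of_monotone _ (fun i => max (ξ i) 0 ^ 2 / 4) n hn hS2
    (fun i _ _ => by positivity) fun i h1 h2 => by
      have := max_le_max_right 0 (hξ i h1 h2).le
      gcongr
  have hQ := sum_mul_nonneg_of_antitone _ (fun i => max (-ξ i) 0 ^ 2 / 4) n hn hS1
    (fun i _ _ => by positivity) fun i h1 h2 => by
      have := max_le_max_right 0 (neg_le_neg (hξ i h1 h2).le)
      gcongr
  have hsplit : ∑ i ∈ Finset.Icc 1 n, (k i * (u (i + 1) - u i) * h (max (ξ i / a i) 0) +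
        k (i - 1) * (u i - u (i - 1)) * h (max (-(ξ i / a (i - 1))) 0)) +
      ∑ i ∈ Finset.Icc 1 n, d i * ξ i ^ 2 / 4 =
      ∑ i ∈ Finset.Icc 1 n, (k i * (u (i + 1) - u i) * Real.log (1 + max (ξ i / a i) 0) +
        k (i - 1) * (u i - u (i - 1)) * Real.log (1 + max (-(ξ i / a (i - 1))) 0)) +
      ∑ i ∈ Finset.Icc 1 n,
        (k i / a i ^ 2 * (u (i + 1) - u i) + d i) * (max (ξ i) 0 ^ 2 / 4) +
      ∑ i ∈ Finset.Icc 1 n,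
        (k (i - 1) / a (i - 1) ^ 2 * (u i - u (i - 1)) + d i) * (max (-ξ i) 0 ^ 2 / 4) := by
    simp only [← Finset.sum_add_distrib]
    refine Finset.sum_congr rfl fun i hi => ?_
    rw [Finset.mem_Icc] at hi
    have hmax : ∀ (r : ℝ) {b : ℝ}, 0 < b → max (r / b) 0 = max r 0 / b := fun r b hb => by
      rw [← max_div_div_right hb.le, zero_div]
    have hsq : ξ i ^ 2 = max (ξ i) 0 ^ 2 + max (-ξ i) 0 ^ 2 := by
      rcases le_total (ξ i) 0 with h | h
      · rw [max_eq_right h, max_eq_left (by linarith)]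
        ring
      · rw [max_eq_left h, max_eq_right (by linarith)]
        ring
    simp only [hh]
    rw [hsq, ← neg_div, hmax _ (ha i hi.2), hmax _ (ha (i - 1) (by omega))]
    ring
  rw [E]
  linarith

lemma max_div_le_of_mul_log_le {w b r c : ℝ} (hw : 0 < w) (hb : 0 < b)
    (h : w * Real.log (1 + max (r / b) 0) ≤ c) : r ≤ b * Real.exp (c / w) := by
  have h1 : Real.log (1 + max (r / b) 0) ≤ c / w := by
    rwa [le_div_iff₀ hw, mul_comm]
  have h0 : 0 ≤ max (r / b) 0 := le_max_right _ _
  rw [Real.log_le_iff_le_exp (by positivity)] at h1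
  have h2 : r / b ≤ Real.exp (c / w) := by linarith [le_max_left (r / b) 0]
  rwa [div_le_iff₀' hb] at h2

/-- Under the coercivity conditions `S^j ≥ 0`, `S_j ≥ 0` (`j = 1,…,n`), every sub-level set
`Ω_c = {ξ̄ ∈ Ω : E(ξ̄) ≤ c}` is bounded in `ℝⁿ`. -/
theorem stmt3 (n : ℕ) (hn : 1 ≤ n) (u a k d : ℕ → ℝ)
    (hu : ∀ i ≤ n, u i < u (i + 1))
    (ha : ∀ i ≤ n, 0 < a i)
    (hk : ∀ i ≤ n, 0 < k i)
    (hS1 : ∀ j, 1 ≤ j → j ≤ n →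
      0 ≤ ∑ i ∈ Finset.Icc 1 j, (k (i - 1) / a (i - 1) ^ 2 * (u i - u (i - 1)) + d i))
    (hS2 : ∀ j, 1 ≤ j → j ≤ n →
      0 ≤ ∑ i ∈ Finset.Icc j n, (k i / a i ^ 2 * (u (i + 1) - u i) + d i)) :
    ∀ c : ℝ, Bornology.IsBounded {x : EuclideanSpace ℝ (Fin n) |
      (∀ i j : Fin n, i < j → x i < x j) ∧ E n u a k d (toSeq n x) ≤ c} := by
  intro c
  let R : ℕ → ℝ := fun i => a i * Real.exp (c / (k i * (u (i + 1) - u i)))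
  refine isBounded_iff_forall_norm_le.2
    ⟨√(∑ i : Fin n, max (R (i + 1)) (R i) ^ 2), ?_⟩
  rintro x ⟨hx, hE⟩
  have hw : ∀ i ≤ n, 0 < k i * (u (i + 1) - u i) := fun i hi =>
    mul_pos (hk i hi) (sub_pos.2 (hu i hi))
  have hlog : ∀ r : ℝ, 0 ≤ Real.log (1 + max r 0) := fun r =>
    Real.log_nonneg (by linarith [le_max_right r 0])
  have hξ : ∀ i, 1 ≤ i → i + 1 ≤ n → toSeq n x i < toSeq n x (i + 1) := by
    intro i h1 h2
    have hn1 : i - 1 < n := by omega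
    have hn2 : i + 1 - 1 < n := by omega
    simp only [toSeq, dif_pos hn1, dif_pos hn2]
    exact hx _ _ (Fin.mk_lt_mk.2 (by omega))
  have hsum := (sum_log_le_E n hn u a k d _ hu ha hk hS1 hS2 hξ).trans hE
  rw [EuclideanSpace.norm_eq]
  refine Real.sqrt_le_sqrt (Finset.sum_le_sum fun i _ => ?_)
  have hi := i.2
  have hval : toSeq n x (i + 1) = x i := by simp [toSeq]
  have hwi := hw i hi.le
  have hwi' := hw (i + 1) hi
  have hterm := (Finset.single_le_sum (fun j hj => ?_)
    (Finset.mem_Icc.2 ⟨Nat.succ_pos i, hi⟩)).trans hsum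
  · simp only [Nat.succ_eq_add_one, Nat.add_sub_cancel, hval] at hterm
    have hpos := mul_nonneg hwi'.le (hlog (x i / a (i + 1)))
    have hneg := mul_nonneg hwi.le (hlog (-(x i / a i)))
    have h1 : x i ≤ R (i + 1) := max_div_le_of_mul_log_le hwi' (ha _ hi) (by linarith)
    have h2 : -x i ≤ R i := max_div_le_of_mul_log_le hwi (ha _ hi.le) (by
      rw [neg_div]
      linarith)
    rw [Real.norm_eq_abs]
    exact pow_le_pow_left₀ (abs_nonneg _) (abs_le.2 ⟨by linarith [le_max_right (R (i + 1)) (R i)], h1.trans (le_max_left _ _)⟩) 2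
  · rw [Finset.mem_Icc] at hj
    have hj' := hw (j - 1) (by omega)
    rw [Nat.sub_add_cancel hj.1] at hj'
    exact add_nonneg (mul_nonneg (hw j hj.2).le (hlog _)) (mul_nonneg hj'.le (hlog _))
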